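/- arXiv:1105.3665 — 2 statements merged into one kernel-verified Lean document; each statement's English description precedes it below -/
import Mathlib

section
/- Let β > 0. The Swendsen–Wang dynamics on spin configurations and the Swendsen–Wang dynamics on random-cluster configurations have the same spectral gap: ‖T·T* − S_{π_β}‖_{π_β} = ‖T*·T − S_{μ_p}‖_{μ_p}, and hence λ(P) = λ(P̃), where P = T·T* on Ω_P and P̃ = T*·T on Ω_RC. -/
open Finset

noncomputable section

/-- Number of connected components of the graph `(V, A)`, counting isolated vertices. -/
def numComp {V : Type*} (A : Finset (Sym2 V)) : ℕ :=
  Nat.card (SimpleGraph.fromEdgeSet (↑A : Set (Sym2 V))).ConnectedComponent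

/-- The set `E(σ)` of edges of `G` whose endpoints receive the same color under `σ`. -/
def monoEdges {V : Type*} [Fintype V] [DecidableEq V] (G : SimpleGraph V)
    [DecidableRel G.Adj] {q : ℕ} (σ : V → Fin q) : Finset (Sym2 V) :=
  G.edgeFinset.filter fun e => ∀ u ∈ e, ∀ w ∈ e, σ u = σ w

/-- The Swendsen–Wang transition matrix on `Ω_P = [q]^V`, with `p = 1 - e^{-β}`. -/
def SW {V : Type*} [Fintype V] [DecidableEq V] (G : SimpleGraph V) [DecidableRel G.Adj]
    (β : ℝ) (q : ℕ) (σ τ : V → Fin q) : ℝ :=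
  ∑ A ∈ (monoEdges G σ ∩ monoEdges G τ).powerset,
    (1 - Real.exp (-β)) ^ A.card * Real.exp (-β) ^ ((monoEdges G σ).card - A.card) *
      ((q : ℝ) ^ numComp A)⁻¹

/-- Partition function `Z(G,β,q)`. -/
def pottsZ {V : Type*} [Fintype V] [DecidableEq V] (G : SimpleGraph V) [DecidableRel G.Adj]
    (β : ℝ) (q : ℕ) : ℝ :=
  ∑ σ : V → Fin q, Real.exp (β * (monoEdges G σ).card)

/-- Boltzmann distribution `π_β` of the `q`-state Potts model on `G`. -/
def potts {V : Type*} [Fintype V] [DecidableEq V] (G : SimpleGraph V) [DecidableRel G.Adj]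
    (β : ℝ) (q : ℕ) (σ : V → Fin q) : ℝ :=
  Real.exp (β * (monoEdges G σ).card) / pottsZ G β q

/-- Heat-bath (single-site Glauber) transition matrix on `Ω_P`. -/
def HB {V : Type*} [Fintype V] [DecidableEq V] (G : SimpleGraph V) [DecidableRel G.Adj]
    (β : ℝ) (q : ℕ) (σ τ : V → Fin q) : ℝ :=
  ((Fintype.card V : ℝ))⁻¹ * ∑ v : V, ∑ k : Fin q,
    if τ = Function.update σ v k then
      potts G β q (Function.update σ v k) / ∑ l : Fin q, potts G β q (Function.update σ v l)
    else 0

/-- `L₂(ν)`-norm of `f`. -/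
def l2norm {Ω : Type*} [Fintype Ω] (ν : Ω → ℝ) (f : Ω → ℝ) : ℝ :=
  Real.sqrt (∑ x, f x ^ 2 * ν x)

/-- Operator norm of the matrix `M` acting on `L₂(ν)`. -/
def opNorm {Ω : Type*} [Fintype Ω] (ν : Ω → ℝ) (M : Ω → Ω → ℝ) : ℝ :=
  sSup {r : ℝ | ∃ f : Ω → ℝ, l2norm ν f ≤ 1 ∧ r = l2norm ν fun x => ∑ y, M x y * f y}

/-- Spectral gap `λ(M) = 1 - ‖M - S_ν‖_ν` of a Markov kernel `M` reversible w.r.t. `ν`. -/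
def specGap {Ω : Type*} [Fintype Ω] (ν : Ω → ℝ) (M : Ω → Ω → ℝ) : ℝ :=
  1 - opNorm ν fun x y => M x y - ν y

/-- Matrix product. -/
def matMul {Ω : Type*} [Fintype Ω] (M N : Ω → Ω → ℝ) : Ω → Ω → ℝ :=
  fun x y => ∑ z, M x z * N z y

end

noncomputable section

/-- The `Ω_P × 2^E` matrix `T(σ,A) = p^{|A|}(1-p)^{|E(σ)|-|A|}·1(A ⊆ E(σ))`, `p = 1 - e^{-β}`. -/
def Tmat {V : Type*} [Fintype V] [DecidableEq V] (G : SimpleGraph V) [DecidableRel G.Adj]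
    {q : ℕ} (β : ℝ) (σ : V → Fin q) (A : Finset (Sym2 V)) : ℝ :=
  if A ⊆ monoEdges G σ then
    (1 - Real.exp (-β)) ^ A.card * Real.exp (-β) ^ ((monoEdges G σ).card - A.card)
  else 0

open scoped Classical in
/-- The `2^E × Ω_P` matrix `T*(A,σ) = q^{-C(A)}·1(σ is constant on every connected component
of `(V,A)`)`. -/
def TstarMat {V : Type*} [Fintype V] {q : ℕ} (A : Finset (Sym2 V)) (σ : V → Fin q) : ℝ :=
  if ∀ u w : V, (SimpleGraph.fromEdgeSet (↑A : Set (Sym2 V))).Reachable u w → σ u = σ w then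
    ((q : ℝ) ^ numComp A)⁻¹
  else 0

end

noncomputable section

/-- The random-cluster state space `Ω_RC = {A : A ⊆ E}`. -/
def RCspace {V : Type*} [Fintype V] [DecidableEq V] (G : SimpleGraph V) [DecidableRel G.Adj] :=
  {A : Finset (Sym2 V) // A ⊆ G.edgeFinset}

instance {V : Type*} [Fintype V] [DecidableEq V] (G : SimpleGraph V) [DecidableRel G.Adj] :
    Fintype (RCspace G) := Subtype.fintype _

/-- The random-cluster measure `μ_p(A) = Z⁻¹ (p/(1-p))^{|A|} q^{C(A)}`, `p = 1 - e^{-β}`. -/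
def rcMeasure {V : Type*} [Fintype V] [DecidableEq V] (G : SimpleGraph V) [DecidableRel G.Adj]
    (β : ℝ) (q : ℕ) (A : RCspace G) : ℝ :=
  ((1 - Real.exp (-β)) / Real.exp (-β)) ^ A.1.card * (q : ℝ) ^ numComp A.1 / pottsZ G β q

/-- The Swendsen–Wang dynamics `P = T·T*` on spin configurations. -/
def swSpin {V : Type*} [Fintype V] [DecidableEq V] (G : SimpleGraph V) [DecidableRel G.Adj]
    (β : ℝ) (q : ℕ) (σ τ : V → Fin q) : ℝ :=
  ∑ A : RCspace G, Tmat G β σ A.1 * TstarMat A.1 τ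

/-- The Swendsen–Wang dynamics `P̃ = T*·T` on random-cluster configurations. -/
def swRC {V : Type*} [Fintype V] [DecidableEq V] (G : SimpleGraph V) [DecidableRel G.Adj]
    (β : ℝ) (q : ℕ) (A B : RCspace G) : ℝ :=
  ∑ σ : V → Fin q, TstarMat A.1 σ * Tmat G β σ B.1

lemma l2norm_eq_norm {Ω : Type*} [Fintype Ω] {ν : Ω → ℝ} (hν : ∀ x, 0 ≤ ν x) (f : Ω → ℝ) :
    l2norm ν f = ‖WithLp.toLp 2 fun x => √(ν x) * f x‖ := by
  rw [EuclideanSpace.norm_eq, l2norm]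
  congr 1
  refine sum_congr rfl fun x _ => ?_
  rw [Real.norm_eq_abs, sq_abs, mul_pow, Real.sq_sqrt (hν x), mul_comm]

/-- The weighted operator norm of `M` is the Euclidean operator norm of its conjugate by
`diag(√ν)`. -/
lemma opNorm_eq_norm {Ω : Type*} [Fintype Ω] [DecidableEq Ω] {ν : Ω → ℝ} (hν : ∀ x, 0 < ν x)
    (M : Ω → Ω → ℝ) :
    opNorm ν M = ‖Matrix.toEuclideanCLM (𝕜 := ℝ)
      (Matrix.of fun x y => √(ν x) * M x y / √(ν y))‖ := by
  have hs : ∀ x, √(ν x) ≠ 0 := fun x => (Real.sqrt_pos.2 (hν x)).ne'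
  have hν' : ∀ x, 0 ≤ ν x := fun x => (hν x).le
  have key : ∀ f : Ω → ℝ, l2norm ν (fun x => ∑ y, M x y * f y) =
      ‖Matrix.toEuclideanCLM (𝕜 := ℝ) (Matrix.of fun x y => √(ν x) * M x y / √(ν y))
        (WithLp.toLp 2 fun x => √(ν x) * f x)‖ := by
    intro f
    rw [l2norm_eq_norm hν', Matrix.toEuclideanCLM_toLp]
    congr 2
    ext x
    simp only [Matrix.mulVec, dotProduct, Matrix.of_apply, mul_sum]
    refine sum_congr rfl fun y _ => ?_
    have := hs y
    field_simp
  rw [← ContinuousLinearMap.sSup_unitClosedBall_eq_norm, opNorm]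
  congr 1
  ext r
  simp only [Set.mem_ofPred_eq, Set.mem_image, mem_closedBall_zero_iff]
  constructor
  · rintro ⟨f, hf, rfl⟩
    exact ⟨_, (l2norm_eq_norm hν' f).symm.trans_le hf, (key f).symm⟩
  · rintro ⟨g, hg, rfl⟩
    have hgf : (WithLp.toLp 2 fun x => √(ν x) * (g x / √(ν x))) = g := by
      ext x
      have := hs x
      simp only
      field_simp
    refine ⟨fun x => g x / √(ν x), ?_, ?_⟩
    · rwa [l2norm_eq_norm hν', hgf]
    · rw [key, hgf]

open scoped Matrix Matrix.Norms.L2Operator in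
/-- If `L` is the adjoint of `K` between weighted `L₂` spaces, then `K L` and `L K` have the same
operator norm. -/
lemma opNorm_mul_adjoint_comm {X Y : Type*} [Fintype X] [Fintype Y] {ν : X → ℝ} {ρ : Y → ℝ}
    (hν : ∀ x, 0 < ν x) (hρ : ∀ y, 0 < ρ y) {K : X → Y → ℝ} {L : Y → X → ℝ}
    (h : ∀ x y, ν x * K x y = ρ y * L y x) :
    opNorm ν (fun x x' => ∑ y, K x y * L y x') = opNorm ρ (fun y y' => ∑ x, L y x * K x y') := by
  classical
  let B : Matrix X Y ℝ := Matrix.of fun x y => √(ν x) * K x y / √(ρ y)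
  have hX : ∀ x, √(ν x) ≠ 0 := fun x => (Real.sqrt_pos.2 (hν x)).ne'
  have hY : ∀ y, √(ρ y) ≠ 0 := fun y => (Real.sqrt_pos.2 (hρ y)).ne'
  have hB : ∀ x y, B x y = √(ρ y) * L y x / √(ν x) := by
    intro x y
    have h' := h x y
    rw [← Real.mul_self_sqrt (hν x).le, ← Real.mul_self_sqrt (hρ y).le] at h'
    simp only [B, Matrix.of_apply]
    rw [div_eq_div_iff (hY y) (hX x)]
    linarith
  have h₁ : (Matrix.of fun x x' => √(ν x) * (∑ y, K x y * L y x') / √(ν x')) = B * Bᴴ := by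
    ext x x'
    simp only [Matrix.of_apply, Matrix.mul_apply, Matrix.conjTranspose_apply, star_trivial,
      mul_sum, sum_div]
    refine sum_congr rfl fun y _ => ?_
    rw [hB x' y]
    simp only [B, Matrix.of_apply]
    have := hY y
    field_simp
  have h₂ : (Matrix.of fun y y' => √(ρ y) * (∑ x, L y x * K x y') / √(ρ y')) = Bᴴ * B := by
    ext y y'
    simp only [Matrix.of_apply, Matrix.mul_apply, Matrix.conjTranspose_apply, star_trivial,
      mul_sum, sum_div]
    refine sum_congr rfl fun x _ => ?_
    rw [hB x y]
    simp only [B, Matrix.of_apply]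
    have := hX x
    field_simp
  rw [opNorm_eq_norm hν, opNorm_eq_norm hρ, h₁, h₂, Matrix.l2_opNorm_toEuclideanCLM,
    Matrix.l2_opNorm_toEuclideanCLM, Matrix.l2_opNorm_conjTranspose_mul_self]
  have := Matrix.l2_opNorm_conjTranspose_mul_self Bᴴ
  rwa [Matrix.conjTranspose_conjTranspose, Matrix.l2_opNorm_conjTranspose] at this

/-- For stochastic matrices `T`, `S` in detailed balance with respect to probability weights `ν`,
`ρ`, the chains `T S` and `S T` are equally far from equilibrium. -/
lemma opNorm_sub_stationary_comm {X Y : Type*} [Fintype X] [Fintype Y] {ν : X → ℝ} {ρ : Y → ℝ}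
    (hν : ∀ x, 0 < ν x) (hρ : ∀ y, 0 < ρ y) (hν1 : ∑ x, ν x = 1) {T : X → Y → ℝ} {S : Y → X → ℝ}
    (h : ∀ x y, ν x * T x y = ρ y * S y x) (hT : ∀ x, ∑ y, T x y = 1)
    (hS : ∀ y, ∑ x, S y x = 1) :
    opNorm ν (fun x x' => ∑ y, T x y * S y x' - ν x') =
      opNorm ρ (fun y y' => ∑ x, S y x * T x y' - ρ y') := by
  have hνT : ∀ y, ∑ x, ν x * T x y = ρ y := fun y => by
    simp only [h, ← mul_sum, hS, mul_one]
  have hρS : ∀ x, ∑ y, ρ y * S y x = ν x := fun x => by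
    simp only [← h, ← mul_sum, hT, mul_one]
  have hρ1 : ∑ y, ρ y = 1 := by
    simp only [← hνT]
    rw [sum_comm]
    simp only [← mul_sum, hT, mul_one, hν1]
  have key := opNorm_mul_adjoint_comm hν hρ (K := fun x y => T x y - ρ y)
    (L := fun y x => S y x - ν x) fun x y => by rw [mul_sub, mul_sub, h, mul_comm (ν x)]
  convert key using 3
  · simp only [sub_mul, mul_sub, sum_sub_distrib, ← sum_mul, hT, hρS, hρ1, one_mul,
      sub_self, sub_zero]
  · simp only [sub_mul, mul_sub, sum_sub_distrib, ← sum_mul, hS, hνT, hν1, one_mul,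
      sub_self, sub_zero]

lemma subset_monoEdges_iff {V : Type*} [Fintype V] [DecidableEq V] {G : SimpleGraph V}
    [DecidableRel G.Adj] {q : ℕ} {A : Finset (Sym2 V)} (hA : A ⊆ G.edgeFinset) (σ : V → Fin q) :
    A ⊆ monoEdges G σ ↔
      ∀ u w : V, (SimpleGraph.fromEdgeSet (↑A : Set (Sym2 V))).Reachable u w → σ u = σ w := by
  constructor
  · rintro h u w ⟨p⟩
    induction p with
    | nil => rfl
    | @cons a b c hab _ ih =>
      rw [SimpleGraph.fromEdgeSet_adj] at hab
      exact ((mem_filter.1 (h (mem_coe.1 hab.1))).2 a (Sym2.mem_mk_left a b) b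
        (Sym2.mem_mk_right a b)).trans ih
  · intro h e he
    refine mem_filter.2 ⟨hA he, fun u hu w hw => ?_⟩
    by_cases huw : u = w
    · rw [huw]
    · apply h
      apply SimpleGraph.Adj.reachable
      rw [SimpleGraph.fromEdgeSet_adj]
      refine ⟨?_, huw⟩
      rwa [← (Sym2.mem_and_mem_iff huw).1 ⟨hu, hw⟩]

lemma sum_Tmat {V : Type*} [Fintype V] [DecidableEq V] (G : SimpleGraph V) [DecidableRel G.Adj]
    {q : ℕ} (β : ℝ) (σ : V → Fin q) : ∑ A : RCspace G, Tmat G β σ A.1 = 1 := by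
  have h₁ : ∑ A : RCspace G, Tmat G β σ A.1 = ∑ A ∈ G.edgeFinset.powerset, Tmat G β σ A :=
    (sum_subtype _ (fun A => mem_powerset) _).symm
  have h₂ : (monoEdges G σ).powerset ⊆ G.edgeFinset.powerset :=
    powerset_mono.2 (filter_subset _ _)
  have h₃ : ∀ A ∈ G.edgeFinset.powerset, A ∉ (monoEdges G σ).powerset → Tmat G β σ A = 0 :=
    fun A _ hA => if_neg fun h => hA (mem_powerset.2 h)
  have h₄ : ∀ A ∈ (monoEdges G σ).powerset, Tmat G β σ A =
      (1 - Real.exp (-β)) ^ #A * Real.exp (-β) ^ (#(monoEdges G σ) - #A) :=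
    fun A hA => if_pos (mem_powerset.1 hA)
  rw [h₁, ← sum_subset h₂ h₃, sum_congr rfl h₄, Finset.sum_pow_mul_eq_add_pow]
  simp

/-- Colorings that are constant on connected components are colorings of the components. -/
def constOnComponentsEquiv {V α : Type*} (H : SimpleGraph V) :
    {σ : V → α // ∀ u w, H.Reachable u w → σ u = σ w} ≃ (H.ConnectedComponent → α) where
  toFun σ := Quot.lift σ.1 σ.2
  invFun τ := ⟨fun v => τ (H.connectedComponentMk v), fun _ _ h =>
    congrArg τ (SimpleGraph.ConnectedComponent.sound h)⟩
  left_inv _ := rfl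
  right_inv τ := by
    ext c
    induction c using SimpleGraph.ConnectedComponent.ind
    rfl

lemma sum_TstarMat {V : Type*} [Fintype V] [DecidableEq V] {q : ℕ} (hq : q ≠ 0)
    (A : Finset (Sym2 V)) : ∑ σ : V → Fin q, TstarMat A σ = 1 := by
  classical
  have h : ∑ σ : V → Fin q, TstarMat A σ = ∑ σ : V → Fin q with ∀ u w,
      (SimpleGraph.fromEdgeSet (↑A : Set (Sym2 V))).Reachable u w → σ u = σ w,
      ((q : ℝ) ^ numComp A)⁻¹ := by
    rw [sum_filter]
    exact sum_congr rfl fun σ _ => by unfold TstarMat; congr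
  rw [h, sum_const, nsmul_eq_mul, ← Fintype.card_subtype, ← Nat.card_eq_fintype_card,
    Nat.card_congr (constOnComponentsEquiv _), Nat.card_fun, Nat.card_fin, numComp, Nat.cast_pow]
  exact mul_inv_cancel₀ (pow_ne_zero _ (Nat.cast_ne_zero.2 hq))

lemma pottsZ_pos {V : Type*} [Fintype V] [DecidableEq V] (G : SimpleGraph V) [DecidableRel G.Adj]
    (β : ℝ) {q : ℕ} (hq : q ≠ 0) : 0 < pottsZ G β q := by
  have : NeZero q := ⟨hq⟩
  exact sum_pos (fun σ _ => Real.exp_pos _) univ_nonempty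

lemma potts_mul_Tmat {V : Type*} [Fintype V] [DecidableEq V] (G : SimpleGraph V)
    [DecidableRel G.Adj] (β : ℝ) {q : ℕ} (hq : q ≠ 0) (σ : V → Fin q) (A : RCspace G) :
    potts G β q σ * Tmat G β σ A.1 = rcMeasure G β q A * TstarMat A.1 σ := by
  by_cases h : A.1 ⊆ monoEdges G σ
  · rw [Tmat, if_pos h, TstarMat, if_pos ((subset_monoEdges_iff A.2 σ).1 h), potts, rcMeasure]
    have hq' : (q : ℝ) ^ numComp A.1 ≠ 0 := pow_ne_zero _ (Nat.cast_ne_zero.2 hq)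
    obtain ⟨k, hk⟩ := Nat.exists_eq_add_of_le (card_le_card h)
    have hZ := (pottsZ_pos G β hq).ne'
    have he : Real.exp (β * ((#A.1 + k : ℕ) : ℝ)) * Real.exp (-β) ^ k =
        (Real.exp (-β) ^ #A.1)⁻¹ := by
      rw [← Real.exp_nat_mul, ← Real.exp_nat_mul, ← Real.exp_add, ← Real.exp_neg]
      push_cast
      ring_nf
    rw [hk, Nat.add_sub_cancel_left, div_pow, div_eq_mul_inv _ (Real.exp (-β) ^ #A.1), ← he]
    field_simp
  · rw [Tmat, if_neg h, TstarMat, if_neg (mt (subset_monoEdges_iff A.2 σ).2 h), mul_zero, mul_zero]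

/-- the Swendsen–Wang dynamics on spins and on random-cluster states have
the same operator norm distance to equilibrium and hence the same spectral gap. -/
theorem swendsen_wang_spin_RC_same_gap
    {V : Type*} [Fintype V] [DecidableEq V]
    (G : SimpleGraph V) [DecidableRel G.Adj]
    (q : ℕ) (hq : 2 ≤ q) (β : ℝ) (hβ : 0 < β) :
    opNorm (potts G β q) (fun σ τ => swSpin G β q σ τ - potts G β q τ) =
        opNorm (rcMeasure G β q) (fun A B => swRC G β q A B - rcMeasure G β q B) ∧
      specGap (potts G β q) (swSpin G β q) =
        specGap (rcMeasure G β q) (swRC G β q) := by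
  have hq0 : q ≠ 0 := by omega
  have hZ := pottsZ_pos G β hq0
  have h : opNorm (potts G β q) (fun σ τ => swSpin G β q σ τ - potts G β q τ) =
      opNorm (rcMeasure G β q) (fun A B => swRC G β q A B - rcMeasure G β q B) := by
    refine opNorm_sub_stationary_comm (fun σ => div_pos (Real.exp_pos _) hZ) (fun A => ?_) ?_
      (potts_mul_Tmat G β hq0) (sum_Tmat G β) fun A => sum_TstarMat hq0 A.1
    · have hp : 0 < 1 - Real.exp (-β) := sub_pos.2 (Real.exp_lt_one_iff.2 (neg_lt_zero.2 hβ))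
      have hq' : (0 : ℝ) < q := Nat.cast_pos.2 (Nat.pos_of_ne_zero hq0)
      exact div_pos (mul_pos (pow_pos (div_pos hp (Real.exp_pos _)) _) (pow_pos hq' _)) hZ
    · rw [← sum_div]
      exact div_self hZ.ne'
  exact ⟨h, congrArg (1 - ·) h⟩

end
end

section
/- Let A and B be stochastic matrices on a finite set Ω, both reversible with respect to the same fully supported probability distribution π. Then A·B·A − S_π = (A − S_π)(B − S_π)(A − S_π), hence ‖A·B·A − S_π‖_π ≤ ‖A − S_π‖_π² · ‖B − S_π‖_π ≤ ‖A − S_π‖_π², and consequently λ(A·B·A) ≥ λ(A²). -/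
open Finset

noncomputable section

section Helpers

variable {Ω : Type*} [Fintype Ω]

/-- Action of a matrix on functions. -/
def matAct (M : Ω → Ω → ℝ) (f : Ω → ℝ) : Ω → ℝ := fun x => ∑ y, M x y * f y

theorem l2norm_nonneg (ν f : Ω → ℝ) : 0 ≤ l2norm ν f := Real.sqrt_nonneg _

theorem l2norm_sq {ν : Ω → ℝ} (hν : ∀ x, 0 < ν x) (f : Ω → ℝ) :
    l2norm ν f ^ 2 = ∑ x, f x ^ 2 * ν x :=
  Real.sq_sqrt (sum_nonneg fun x _ => mul_nonneg (sq_nonneg _) (hν x).le)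

theorem l2norm_const_mul (ν f : Ω → ℝ) (c : ℝ) :
    l2norm ν (fun x => c * f x) = |c| * l2norm ν f := by
  unfold l2norm
  rw [← Real.sqrt_sq_eq_abs, ← Real.sqrt_mul (sq_nonneg c), mul_sum]
  congr 1
  exact sum_congr rfl fun x _ => by ring

theorem eq_zero_of_l2norm_eq_zero {ν : Ω → ℝ} (hν : ∀ x, 0 < ν x) {f : Ω → ℝ}
    (hf : l2norm ν f = 0) : f = 0 := by
  have h := l2norm_sq hν f
  rw [hf, zero_pow two_ne_zero, eq_comm,
    sum_eq_zero_iff_of_nonneg fun x _ => mul_nonneg (sq_nonneg _) (hν x).le] at h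
  funext x
  simpa [(hν x).ne'] using h x (mem_univ x)

/-- Cauchy–Schwarz inequality in `L₂(ν)`. -/
theorem sq_sum_mul_le {ν : Ω → ℝ} (hν : ∀ x, 0 < ν x) (f g : Ω → ℝ) :
    (∑ x, f x * g x * ν x) ^ 2 ≤ (∑ x, f x ^ 2 * ν x) * ∑ x, g x ^ 2 * ν x :=
  sum_sq_le_sum_mul_sum_of_sq_le_mul _
    (fun x _ => mul_nonneg (sq_nonneg _) (hν x).le)
    (fun x _ => mul_nonneg (sq_nonneg _) (hν x).le)
    (fun x _ => le_of_eq (by ring))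

theorem sum_mul_le_l2norm_mul {ν : Ω → ℝ} (hν : ∀ x, 0 < ν x) (f g : Ω → ℝ) :
    ∑ x, f x * g x * ν x ≤ l2norm ν f * l2norm ν g := by
  refine le_of_pow_le_pow_left₀ two_ne_zero (mul_nonneg (l2norm_nonneg _ _) (l2norm_nonneg _ _)) ?_
  rw [mul_pow, l2norm_sq hν, l2norm_sq hν]
  exact sq_sum_mul_le hν f g

theorem bddAbove_l2norm_matAct {ν : Ω → ℝ} (hν : ∀ x, 0 < ν x) (M : Ω → Ω → ℝ) :
    BddAbove {r : ℝ | ∃ f : Ω → ℝ, l2norm ν f ≤ 1 ∧ r = l2norm ν (matAct M f)} := by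
  refine ⟨Real.sqrt (∑ x, (∑ y, (M x y / ν y) ^ 2 * ν y) * ν x), ?_⟩
  rintro r ⟨f, hf, rfl⟩
  refine Real.sqrt_le_sqrt (sum_le_sum fun x _ => mul_le_mul_of_nonneg_right ?_ (hν x).le)
  have hf2 : ∑ y, f y ^ 2 * ν y ≤ 1 := by
    rw [← l2norm_sq hν]
    exact pow_le_one₀ (l2norm_nonneg _ _) hf
  have hM : matAct M f x = ∑ y, M x y / ν y * f y * ν y :=
    sum_congr rfl fun y _ => by have := (hν y).ne'; field_simp
  rw [hM]
  exact (sq_sum_mul_le hν _ f).trans (mul_le_of_le_one_right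
    (sum_nonneg fun y _ => mul_nonneg (sq_nonneg _) (hν y).le) hf2)

theorem opNorm_nonneg (ν : Ω → ℝ) (M : Ω → Ω → ℝ) : 0 ≤ opNorm ν M := by
  refine Real.sSup_nonneg ?_
  rintro r ⟨f, -, rfl⟩
  exact l2norm_nonneg _ _

theorem l2norm_matAct_le {ν : Ω → ℝ} (hν : ∀ x, 0 < ν x) (M : Ω → Ω → ℝ) (f : Ω → ℝ) :
    l2norm ν (matAct M f) ≤ opNorm ν M * l2norm ν f := by
  rcases (l2norm_nonneg ν f).eq_or_lt with h | h
  · obtain rfl := eq_zero_of_l2norm_eq_zero hν h.symm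
    simp [matAct, l2norm]
  · have hle : l2norm ν (matAct M fun x => (l2norm ν f)⁻¹ * f x) ≤ opNorm ν M := by
      refine le_csSup (bddAbove_l2norm_matAct hν M) ⟨_, ?_, rfl⟩
      rw [l2norm_const_mul, abs_of_pos (inv_pos.2 h), inv_mul_cancel₀ h.ne']
    have hM : (matAct M fun x => (l2norm ν f)⁻¹ * f x)
        = fun x => (l2norm ν f)⁻¹ * matAct M f x := by
      funext x
      simp only [matAct, mul_sum]
      exact sum_congr rfl fun y _ => by ring
    rwa [hM, l2norm_const_mul, abs_of_pos (inv_pos.2 h), inv_mul_le_iff₀ h, mul_comm] at hle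

theorem opNorm_le {ν : Ω → ℝ} {M : Ω → Ω → ℝ} {C : ℝ} (hC : 0 ≤ C)
    (h : ∀ f, l2norm ν (matAct M f) ≤ C * l2norm ν f) : opNorm ν M ≤ C := by
  refine Real.sSup_le ?_ hC
  rintro r ⟨f, hf, rfl⟩
  exact (h f).trans (mul_le_of_le_one_right hC hf)

theorem matAct_matMul (M N : Ω → Ω → ℝ) (f : Ω → ℝ) :
    matAct (matMul M N) f = matAct M (matAct N f) := by
  funext x
  simp only [matAct, matMul, sum_mul, mul_sum]
  rw [sum_comm]
  exact sum_congr rfl fun y _ => sum_congr rfl fun z _ => by ring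

theorem opNorm_matMul_le {ν : Ω → ℝ} (hν : ∀ x, 0 < ν x) (M N : Ω → Ω → ℝ) :
    opNorm ν (matMul M N) ≤ opNorm ν M * opNorm ν N := by
  refine opNorm_le (mul_nonneg (opNorm_nonneg _ _) (opNorm_nonneg _ _)) fun f => ?_
  rw [matAct_matMul, mul_assoc]
  exact (l2norm_matAct_le hν M _).trans
    (mul_le_mul_of_nonneg_left (l2norm_matAct_le hν N f) (opNorm_nonneg _ _))

theorem sum_matAct_mul {ν : Ω → ℝ} {M : Ω → Ω → ℝ}
    (hM : ∀ x y, ν x * M x y = ν y * M y x) (f g : Ω → ℝ) :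
    ∑ x, matAct M f x * g x * ν x = ∑ x, f x * matAct M g x * ν x := by
  simp only [matAct, sum_mul, mul_sum]
  rw [sum_comm]
  exact sum_congr rfl fun y _ => sum_congr rfl fun x _ => by
    linear_combination f y * g x * hM x y

theorem opNorm_sq_le_opNorm_matMul_self {ν : Ω → ℝ} (hν : ∀ x, 0 < ν x) {M : Ω → Ω → ℝ}
    (hM : ∀ x y, ν x * M x y = ν y * M y x) :
    opNorm ν M ^ 2 ≤ opNorm ν (matMul M M) := by
  rw [← Real.le_sqrt (opNorm_nonneg _ _) (opNorm_nonneg _ _)]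
  refine opNorm_le (Real.sqrt_nonneg _) fun f => ?_
  refine le_of_pow_le_pow_left₀ two_ne_zero (mul_nonneg (Real.sqrt_nonneg _) (l2norm_nonneg _ _)) ?_
  rw [mul_pow, Real.sq_sqrt (opNorm_nonneg _ _)]
  calc l2norm ν (matAct M f) ^ 2 = ∑ x, matAct M f x * matAct M f x * ν x := by
        rw [l2norm_sq hν]
        exact sum_congr rfl fun x _ => by ring
    _ = ∑ x, f x * matAct (matMul M M) f x * ν x := by
        rw [sum_matAct_mul hM, matAct_matMul]
    _ ≤ l2norm ν f * l2norm ν (matAct (matMul M M) f) := sum_mul_le_l2norm_mul hν _ _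
    _ ≤ l2norm ν f * (opNorm ν (matMul M M) * l2norm ν f) :=
        mul_le_mul_of_nonneg_left (l2norm_matAct_le hν _ f) (l2norm_nonneg _ _)
    _ = opNorm ν (matMul M M) * l2norm ν f ^ 2 := by ring

theorem stationary_of_reversible {ν : Ω → ℝ} {M : Ω → Ω → ℝ} (hM1 : ∀ x, ∑ y, M x y = 1)
    (hM : ∀ x y, ν x * M x y = ν y * M y x) (y : Ω) : ∑ x, ν x * M x y = ν y := by
  simp only [hM _ y, ← mul_sum, hM1, mul_one]

theorem matMul_stationary {ν : Ω → ℝ} {M N : Ω → Ω → ℝ} (hM : ∀ y, ∑ x, ν x * M x y = ν y)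
    (hN : ∀ y, ∑ x, ν x * N x y = ν y) (y : Ω) : ∑ x, ν x * matMul M N x y = ν y := by
  simp only [matMul, mul_sum]
  rw [sum_comm]
  simp only [← mul_assoc, ← sum_mul, hM, hN]

theorem matMul_sub_stationary {ν : Ω → ℝ} (hν1 : ∑ x, ν x = 1) {M N : Ω → Ω → ℝ}
    (hM : ∀ x, ∑ y, M x y = 1) (hN : ∀ y, ∑ x, ν x * N x y = ν y) :
    matMul (fun x y => M x y - ν y) (fun x y => N x y - ν y)
      = fun x y => matMul M N x y - ν y := by
  funext x y
  simp only [matMul, sub_mul, mul_sub, sum_sub_distrib, ← sum_mul, hM, hN, hν1]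
  ring

theorem opNorm_sub_stationary_le_one {ν : Ω → ℝ} (hν : ∀ x, 0 < ν x) (hν1 : ∑ x, ν x = 1)
    {M : Ω → Ω → ℝ} (hM0 : ∀ x y, 0 ≤ M x y) (hM1 : ∀ x, ∑ y, M x y = 1)
    (hM : ∀ y, ∑ x, ν x * M x y = ν y) : opNorm ν (fun x y => M x y - ν y) ≤ 1 := by
  refine opNorm_le zero_le_one fun f => ?_
  rw [one_mul]
  refine le_of_pow_le_pow_left₀ two_ne_zero (l2norm_nonneg _ _) ?_
  rw [l2norm_sq hν, l2norm_sq hν]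
  have hmean : ∑ x, matAct M f x * ν x = ∑ y, ν y * f y := by
    simp only [matAct, sum_mul]
    rw [sum_comm]
    refine sum_congr rfl fun y _ => ?_
    rw [← hM y, sum_mul]
    exact sum_congr rfl fun x _ => by ring
  have hact (x : Ω) : matAct (fun x y => M x y - ν y) f x = matAct M f x - ∑ y, ν y * f y := by
    simp only [matAct, sub_mul, sum_sub_distrib]
  have hvar : ∑ x, (matAct M f x - ∑ y, ν y * f y) ^ 2 * ν x
      = ∑ x, matAct M f x ^ 2 * ν x - (∑ y, ν y * f y) ^ 2 := by
    set m := ∑ y, ν y * f y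
    have hexp (x : Ω) : (matAct M f x - m) ^ 2 * ν x
        = matAct M f x ^ 2 * ν x - 2 * m * (matAct M f x * ν x) + m ^ 2 * ν x := by ring
    simp only [hexp, sum_add_distrib, sum_sub_distrib, ← mul_sum, hmean, hν1]
    ring
  have hjensen (x : Ω) : matAct M f x ^ 2 ≤ ∑ y, M x y * f y ^ 2 := by
    have h := sum_sq_le_sum_mul_sum_of_sq_le_mul univ (r := fun y => M x y * f y)
      (fun y _ => hM0 x y) (fun y _ => mul_nonneg (hM0 x y) (sq_nonneg (f y)))
      (fun y _ => le_of_eq (by ring))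
    rwa [hM1, one_mul] at h
  simp only [hact, hvar]
  calc ∑ x, matAct M f x ^ 2 * ν x - (∑ y, ν y * f y) ^ 2
      ≤ ∑ x, matAct M f x ^ 2 * ν x := sub_le_self _ (sq_nonneg _)
    _ ≤ ∑ x, (∑ y, M x y * f y ^ 2) * ν x :=
        sum_le_sum fun x _ => mul_le_mul_of_nonneg_right (hjensen x) (hν x).le
    _ = ∑ y, f y ^ 2 * ν y := by
        simp only [sum_mul]
        rw [sum_comm]
        refine sum_congr rfl fun y _ => ?_
        rw [← hM y, mul_sum]
        exact sum_congr rfl fun x _ => by ring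

end Helpers

/-- for stochastic matrices `A, B` reversible w.r.t. the same fully
supported distribution `π`, one has `A·B·A - S_π = (A - S_π)(B - S_π)(A - S_π)`, hence
`‖A·B·A - S_π‖ ≤ ‖A - S_π‖²·‖B - S_π‖ ≤ ‖A - S_π‖²`, and consequently `λ(A·B·A) ≥ λ(A²)`. -/
theorem sandwich_gap_bound
    {Ω : Type*} [Fintype Ω]
    (π : Ω → ℝ) (hπpos : ∀ x, 0 < π x) (hπsum : ∑ x, π x = 1)
    (A B : Ω → Ω → ℝ)
    (hA0 : ∀ x y, 0 ≤ A x y) (hA1 : ∀ x, ∑ y, A x y = 1)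
    (hB0 : ∀ x y, 0 ≤ B x y) (hB1 : ∀ x, ∑ y, B x y = 1)
    (hArev : ∀ x y, π x * A x y = π y * A y x)
    (hBrev : ∀ x y, π x * B x y = π y * B y x) :
    (∀ x y, matMul A (matMul B A) x y - π y =
        matMul (fun a b => A a b - π b)
          (matMul (fun a b => B a b - π b) (fun a b => A a b - π b)) x y) ∧
      opNorm π (fun x y => matMul A (matMul B A) x y - π y) ≤
        opNorm π (fun x y => A x y - π y) ^ 2 * opNorm π (fun x y => B x y - π y) ∧
      opNorm π (fun x y => A x y - π y) ^ 2 * opNorm π (fun x y => B x y - π y) ≤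
        opNorm π (fun x y => A x y - π y) ^ 2 ∧
      specGap π (matMul A (matMul B A)) ≥ specGap π (matMul A A) := by
  have hAst := stationary_of_reversible hA1 hArev
  have hBst := stationary_of_reversible hB1 hBrev
  have hprod : (fun x y => matMul A (matMul B A) x y - π y)
      = matMul (fun a b => A a b - π b)
          (matMul (fun a b => B a b - π b) (fun a b => A a b - π b)) := by
    rw [matMul_sub_stationary hπsum hB1 hAst,
      matMul_sub_stationary hπsum hA1 (matMul_stationary hBst hAst)]
  have hnorm : opNorm π (fun x y => matMul A (matMul B A) x y - π y) ≤
      opNorm π (fun x y => A x y - π y) ^ 2 * opNorm π (fun x y => B x y - π y) := by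
    rw [hprod]
    refine (opNorm_matMul_le hπpos _ _).trans ((mul_le_mul_of_nonneg_left
      (opNorm_matMul_le hπpos _ _) (opNorm_nonneg _ _)).trans_eq ?_)
    ring
  have hcontr : opNorm π (fun x y => A x y - π y) ^ 2 * opNorm π (fun x y => B x y - π y) ≤
      opNorm π (fun x y => A x y - π y) ^ 2 :=
    mul_le_of_le_one_right (sq_nonneg _)
      (opNorm_sub_stationary_le_one hπpos hπsum hB0 hB1 hBst)
  have hsq : opNorm π (fun x y => A x y - π y) ^ 2 ≤
      opNorm π (fun x y => matMul A A x y - π y) := by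
    rw [← matMul_sub_stationary hπsum hA1 hAst]
    exact opNorm_sq_le_opNorm_matMul_self hπpos fun x y => by linear_combination hArev x y
  exact ⟨fun x y => congrFun₂ hprod x y, hnorm, hcontr,
    sub_le_sub_left ((hnorm.trans hcontr).trans hsq) 1⟩

end
end
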